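/- arXiv:0910.4948 — 3 statements merged into one kernel-verified Lean document; each statement's English description precedes it below -/
import Mathlib

section
/- Let I be a small monoidal category and let (C, ⊗, e) be a monoidal category with all small colimits such that the tensor product of C preserves colimits in each variable. Given a strong monoidal functor F : I → C, the unique colimit-preserving extension F̂ : Set^{Iᵒᵖ} → C of F along the Yoneda embedding is strong monoidal with respect to the Day convolution monoidal structure on Set^{Iᵒᵖ}. If moreover I and C are symmetric monoidal and F is symmetric strong monoidal, then F̂ is symmetric strong monoidal. -/
open CategoryTheory Limits MonoidalCategory

universe v u

/-- The category of presheaves of sets on a small category, as a type synonym, so that the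
Day convolution monoidal structure can be hypothesized on it unambiguously. -/
def PSh (I : Type u) [SmallCategory I] : Type (u + 1) := Iᵒᵖ ⥤ Type u

instance (I : Type u) [SmallCategory I] : Category.{u} (PSh I) :=
  inferInstanceAs (Category (Iᵒᵖ ⥤ Type u))

/-- The Yoneda embedding into the presheaf category. -/
def pshYoneda (I : Type u) [SmallCategory I] : I ⥤ PSh I := yoneda

noncomputable section

open Functor

instance (I : Type u) [SmallCategory I] : (pshYoneda I).IsDense :=
  inferInstanceAs (yoneda (C := I)).IsDense

namespace DenseExtension

universe w w'

variable {I : Type u} [SmallCategory I] {P : Type w} [Category.{u} P] (L : I ⥤ P)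

section InducedTensorator

variable {C : Type v} [Category.{w'} C] [MonoidalCategory I] [MonoidalCategory P]
  [MonoidalCategory C] [L.Monoidal] (F : I ⥤ C) [F.Monoidal] (G : P ⥤ C) (e : L ⋙ G ≅ F)

/-- `μ` is the tensorator on `G` induced by the one of `F` along `e : L ⋙ G ≅ F`. -/
def IsInducedTensorator (μ : curriedTensorPre G ⟶ curriedTensorPost G) : Prop :=
  ∀ i j, (μ.app (L.obj i)).app (L.obj j) =
    (e.hom.app i ⊗ₘ e.hom.app j) ≫ LaxMonoidal.μ F i j ≫ e.inv.app (i ⊗ j) ≫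
      G.map (OplaxMonoidal.δ L i j)

variable {L F G e} in
lemma IsInducedTensorator.app_app {μ : curriedTensorPre G ⟶ curriedTensorPost G}
    (hμ : IsInducedTensorator L F G e μ) {X₁ X₂ : I} {Y₁ Y₂ : P}
    (e₁ : Y₁ ≅ L.obj X₁) (e₂ : Y₂ ≅ L.obj X₂) :
    (μ.app Y₁).app Y₂ =
      ((G.map e₁.hom ≫ e.hom.app _) ⊗ₘ (G.map e₂.hom ≫ e.hom.app _)) ≫
        LaxMonoidal.μ F X₁ X₂ ≫ e.inv.app _ ≫
        G.map (OplaxMonoidal.δ L _ _ ≫ (e₁.inv ⊗ₘ e₂.inv)) := by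
  have h₁ := (μ.app Y₁).naturality e₂.hom
  have h₂ := NatTrans.congr_app (μ.naturality e₁.hom)
  dsimp at h₁ h₂ ⊢
  rw [← cancel_mono (G.map (Y₁ ◁ e₂.hom)), ← h₁, ← cancel_mono (G.map (e₁.hom ▷ L.obj X₂)),
    Category.assoc, ← h₂, hμ, Category.assoc, Category.assoc,
    Category.assoc, Category.assoc, ← tensorHom_def'_assoc, tensorHom_comp_tensorHom_assoc,
    ← Functor.map_comp, ← tensorHom_def', ← Functor.map_comp, Category.assoc,
    tensorHom_comp_tensorHom, Iso.inv_hom_id, Iso.inv_hom_id, tensorHom_id, id_whiskerRight,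
    Category.comp_id]

end InducedTensorator

variable [L.IsDense]

/-- A functor preserving small colimits is the left Kan extension of its restriction along
a dense functor from a small category. -/
lemma isLeftKanExtension_of_preservesColimits {D : Type v} [Category.{w'} D]
    (H : P ⥤ D) [PreservesColimitsOfSize.{u, u} H] :
    H.IsLeftKanExtension (𝟙 (L ⋙ H)) := by
  apply Functor.LeftExtension.IsPointwiseLeftKanExtension.isLeftKanExtension
    (E := Functor.LeftExtension.mk _ (𝟙 (L ⋙ H)))
  intro X
  exact IsColimit.ofIsoColimit (isColimitOfPreserves H (L.denseAt X))
    (Cocone.ext (Iso.refl _) fun _ ↦ (Category.comp_id _).trans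
      ((congrArg H.map (Category.id_comp _)).trans (Category.id_comp _).symm))

lemma natTrans_ext {D : Type v} [Category.{w'} D]
    {H K : P ⥤ D} [PreservesColimitsOfSize.{u, u} H] {α β : H ⟶ K}
    (h : ∀ i, α.app (L.obj i) = β.app (L.obj i)) : α = β := by
  have := isLeftKanExtension_of_preservesColimits L H
  apply H.hom_ext_of_isLeftKanExtension (𝟙 (L ⋙ H))
  ext i
  simp [h]

lemma exists_iso {D : Type v} [Category.{w'} D] {H K : P ⥤ D}
    [PreservesColimitsOfSize.{u, u} H] [PreservesColimitsOfSize.{u, u} K]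
    (φ : L ⋙ H ≅ L ⋙ K) :
    ∃ ψ : H ≅ K, ∀ i, ψ.hom.app (L.obj i) = φ.hom.app i := by
  have := isLeftKanExtension_of_preservesColimits L H
  have := isLeftKanExtension_of_preservesColimits L K
  refine ⟨H.leftKanExtensionUniqueOfIso (𝟙 (L ⋙ H)) φ K (𝟙 (L ⋙ K)), fun i ↦ ?_⟩
  simpa using H.descOfIsLeftKanExtension_fac_app (𝟙 (L ⋙ H)) K (φ.hom ≫ 𝟙 _) i

variable {C : Type v} [Category.{w'} C]

lemma natTrans₂_ext {H K : P ⥤ P ⥤ C}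
    (h₁ : ∀ X, PreservesColimitsOfSize.{u, u} (H.flip.obj X))
    (h₂ : ∀ X, PreservesColimitsOfSize.{u, u} (H.obj X)) {α β : H ⟶ K}
    (h : ∀ i j, (α.app (L.obj i)).app (L.obj j) = (β.app (L.obj i)).app (L.obj j)) :
    α = β := by
  ext X Y
  have key (i : I) : α.app (L.obj i) = β.app (L.obj i) := natTrans_ext L (h i)
  exact NatTrans.congr_app (natTrans_ext L (H := H.flip.obj Y) (K := K.flip.obj Y)
    (α := (flipFunctor _ _ _).map α |>.app Y)
    (β := (flipFunctor _ _ _).map β |>.app Y) (fun i ↦ NatTrans.congr_app (key i) Y)) X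

lemma natTrans₃_ext {H K : P ⥤ P ⥤ P ⥤ C}
    (h₁ : ∀ Y Z, PreservesColimitsOfSize.{u, u} ((H.flip.obj Y).flip.obj Z))
    (h₂ : ∀ X Z, PreservesColimitsOfSize.{u, u} ((H.obj X).flip.obj Z))
    (h₃ : ∀ X Y, PreservesColimitsOfSize.{u, u} ((H.obj X).obj Y)) {α β : H ⟶ K}
    (h : ∀ i j k, ((α.app (L.obj i)).app (L.obj j)).app (L.obj k) =
      ((β.app (L.obj i)).app (L.obj j)).app (L.obj k)) :
    α = β := by
  ext X Y Z
  have key (i : I) : α.app (L.obj i) = β.app (L.obj i) :=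
    natTrans₂_ext L (h₂ _) (h₃ _) (h i)
  have := natTrans_ext L (H := (H.flip.obj Y).flip.obj Z) (K := (K.flip.obj Y).flip.obj Z)
    (α := (flipFunctor _ _ _).map ((flipFunctor _ _ _).map α |>.app Y) |>.app Z)
    (β := (flipFunctor _ _ _).map ((flipFunctor _ _ _).map β |>.app Y) |>.app Z)
    (fun i ↦ NatTrans.congr_app (NatTrans.congr_app (key i) Y) Z)
  exact NatTrans.congr_app this X

lemma exists_iso₂ {H K : P ⥤ P ⥤ C}
    (h₁ : ∀ X, PreservesColimitsOfSize.{u, u} (H.flip.obj X))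
    (h₂ : ∀ X, PreservesColimitsOfSize.{u, u} (H.obj X))
    (k₁ : ∀ X, PreservesColimitsOfSize.{u, u} (K.flip.obj X))
    (k₂ : ∀ X, PreservesColimitsOfSize.{u, u} (K.obj X))
    (φ : (((whiskeringLeft₂ C).obj L).obj L).obj H ≅
      (((whiskeringLeft₂ C).obj L).obj L).obj K) :
    ∃ ψ : H ≅ K, ∀ i j,
      (ψ.hom.app (L.obj i)).app (L.obj j) = (φ.hom.app i).app j := by
  choose ψ hψ using fun i ↦ exists_iso L (H := H.obj (L.obj i)) (K := K.obj (L.obj i)) (φ.app i)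
  have nat {i j : I} (f : i ⟶ j) :
      H.map (L.map f) ≫ (ψ j).hom = (ψ i).hom ≫ K.map (L.map f) :=
    natTrans_ext L fun k ↦ by
      have := NatTrans.congr_app (φ.hom.naturality f) k
      simp only [NatTrans.comp_app, hψ]
      exact this
  choose χ hχ using fun Y ↦ exists_iso L (H := H.flip.obj Y) (K := K.flip.obj Y)
    (NatIso.ofComponents (fun i ↦ (ψ i).app Y) fun f ↦ NatTrans.congr_app (nat f) Y)
  let ξ : H.flip ≅ K.flip := NatIso.ofComponents χ fun {Y Z} g ↦ natTrans_ext L fun i ↦ by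
    have h := hχ Y i
    have h' := hχ Z i
    dsimp at h h' ⊢
    rw [h, h']
    exact (ψ i).hom.naturality g
  refine ⟨(flipFunctor _ _ _).mapIso ξ, fun i j ↦ ?_⟩
  exact (hχ (L.obj j) i).trans (hψ i j)

lemma preservesColimits_curriedTensorPre_obj [MonoidalCategory C] (G : P ⥤ C)
    [PreservesColimitsOfSize.{u, u} G]
    [∀ X : C, PreservesColimitsOfSize.{u, u} (tensorLeft X)] (X : P) :
    PreservesColimitsOfSize.{u, u} ((curriedTensorPre G).obj X) :=
  inferInstanceAs (PreservesColimitsOfSize.{u, u} (G ⋙ tensorLeft (G.obj X)))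

lemma preservesColimits_curriedTensorPre_flip_obj [MonoidalCategory C] (G : P ⥤ C)
    [PreservesColimitsOfSize.{u, u} G]
    [∀ X : C, PreservesColimitsOfSize.{u, u} (tensorRight X)] (X : P) :
    PreservesColimitsOfSize.{u, u} ((curriedTensorPre G).flip.obj X) :=
  inferInstanceAs (PreservesColimitsOfSize.{u, u} (G ⋙ tensorRight (G.obj X)))

/-- Associativity is preserved by conjugation with isomorphisms. -/
lemma associativity_of_conjugates [MonoidalCategory C]
    {A₁ A₂ A₃ A₁₂ A₂₃ B₁ B₂ B₃ B₁₂ B₂₃ D D' Z : C}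
    (a₁ : A₁ ⟶ B₁) (a₂ : A₂ ⟶ B₂) (a₃ : A₃ ⟶ B₃)
    {f : B₁ ⊗ B₂ ⟶ B₁₂} {g : B₂ ⊗ B₃ ⟶ B₂₃} {m : B₁₂ ⊗ B₃ ⟶ D} {m' : B₁ ⊗ B₂₃ ⟶ D'}
    {c₁₂ : B₁₂ ⟶ A₁₂} {d₁₂ : A₁₂ ⟶ B₁₂} (h₁₂ : c₁₂ ≫ d₁₂ = 𝟙 _)
    {c₂₃ : B₂₃ ⟶ A₂₃} {d₂₃ : A₂₃ ⟶ B₂₃} (h₂₃ : c₂₃ ≫ d₂₃ = 𝟙 _)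
    {α : D ⟶ D'} (hα : f ▷ B₃ ≫ m ≫ α = (α_ B₁ B₂ B₃).hom ≫ B₁ ◁ g ≫ m')
    {p : D ⟶ Z} {p' : D' ⟶ Z} (hp : p = α ≫ p') :
    ((a₁ ⊗ₘ a₂) ≫ f ≫ c₁₂) ▷ A₃ ≫ (d₁₂ ⊗ₘ a₃) ≫ m ≫ p =
      (α_ A₁ A₂ A₃).hom ≫ A₁ ◁ ((a₂ ⊗ₘ a₃) ≫ g ≫ c₂₃) ≫ (a₁ ⊗ₘ d₂₃) ≫ m' ≫ p' := by
  have hl : ((a₁ ⊗ₘ a₂) ≫ f ≫ c₁₂) ▷ A₃ ≫ (d₁₂ ⊗ₘ a₃) =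
      ((a₁ ⊗ₘ a₂) ⊗ₘ a₃) ≫ f ▷ B₃ := by
    rw [← tensorHom_id, tensorHom_comp_tensorHom, ← tensorHom_id, tensorHom_comp_tensorHom]
    simp [h₁₂]
  have hr : A₁ ◁ ((a₂ ⊗ₘ a₃) ≫ g ≫ c₂₃) ≫ (a₁ ⊗ₘ d₂₃) =
      (a₁ ⊗ₘ (a₂ ⊗ₘ a₃)) ≫ B₁ ◁ g := by
    rw [← id_tensorHom, tensorHom_comp_tensorHom, ← id_tensorHom, tensorHom_comp_tensorHom]
    simp [h₂₃]
  rw [reassoc_of% hl, reassoc_of% hr, hp, reassoc_of% hα, associator_naturality_assoc]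

section Monoidal

variable [MonoidalCategory I] [MonoidalCategory P] [MonoidalCategory C] [L.Monoidal]
  (F : I ⥤ C) [F.Monoidal] (G : P ⥤ C) (e : L ⋙ G ≅ F)
  [PreservesColimitsOfSize.{u, u} G]
  [∀ X : C, PreservesColimitsOfSize.{u, u} (tensorLeft X)]
  [∀ X : C, PreservesColimitsOfSize.{u, u} (tensorRight X)]
  [∀ X : P, PreservesColimitsOfSize.{u, u} (tensorLeft X)]
  [∀ X : P, PreservesColimitsOfSize.{u, u} (tensorRight X)]

lemma exists_isInducedTensorator :
    ∃ μ : curriedTensorPre G ≅ curriedTensorPost G, IsInducedTensorator L F G e μ.hom := by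
  obtain ⟨μ, hμ⟩ := exists_iso₂ L (H := curriedTensorPre G) (K := curriedTensorPost G)
    (preservesColimits_curriedTensorPre_flip_obj G)
    (preservesColimits_curriedTensorPre_obj G)
    (fun X ↦ inferInstanceAs (PreservesColimitsOfSize.{u, u} (tensorRight X ⋙ G)))
    (fun X ↦ inferInstanceAs (PreservesColimitsOfSize.{u, u} (tensorLeft X ⋙ G)))
    (curriedTensorPreFunctor.mapIso e ≪≫ Functor.curriedTensorPreIsoPost F ≪≫
      curriedTensorPostFunctor.mapIso e.symm ≪≫
      (postcompose₂.obj G).mapIso (Functor.curriedTensorPreIsoPost L).symm)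
  exact ⟨μ, fun i j ↦ (hμ i j).trans rfl⟩

variable {L F G e}

open Functor.Monoidal in
/-- The monoidal structure on `G` with an induced tensorator. -/
def coreMonoidal (μ : curriedTensorPre G ≅ curriedTensorPost G)
    (hμ : IsInducedTensorator L F G e μ.hom) : G.CoreMonoidal := by
  refine Functor.CoreMonoidal.ofBifunctor
    (εIso F ≪≫ e.symm.app _ ≪≫ G.mapIso (εIso L).symm) μ ?_ ?_ ?_
  · refine natTrans₃_ext L
      (fun Y Z ↦ inferInstanceAs (PreservesColimitsOfSize.{u, u}
        (G ⋙ tensorRight (G.obj Y) ⋙ tensorRight (G.obj Z))))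
      (fun X Z ↦ inferInstanceAs (PreservesColimitsOfSize.{u, u}
        (G ⋙ tensorLeft (G.obj X) ⋙ tensorRight (G.obj Z))))
      (fun X Y ↦ inferInstanceAs (PreservesColimitsOfSize.{u, u}
        (G ⋙ tensorLeft (G.obj X ⊗ G.obj Y)))) (fun X₁ X₂ X₃ ↦ ?_)
    change (μ.hom.app (L.obj X₁)).app (L.obj X₂) ▷ G.obj (L.obj X₃) ≫
        (μ.hom.app (L.obj X₁ ⊗ L.obj X₂)).app (L.obj X₃) ≫ G.map (α_ _ _ _).hom =
      (α_ _ _ _).hom ≫ G.obj (L.obj X₁) ◁ (μ.hom.app (L.obj X₂)).app (L.obj X₃) ≫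
        (μ.hom.app (L.obj X₁)).app (L.obj X₂ ⊗ L.obj X₃)
    rw [hμ, hμ, hμ.app_app (μIso L _ _) (Iso.refl _), hμ.app_app (Iso.refl _) (μIso L _ _)]
    have hL : OplaxMonoidal.δ L (X₁ ⊗ X₂) X₃ ≫ OplaxMonoidal.δ L X₁ X₂ ▷ L.obj X₃ ≫
        (α_ (L.obj X₁) (L.obj X₂) (L.obj X₃)).hom = L.map (α_ X₁ X₂ X₃).hom ≫
          OplaxMonoidal.δ L X₁ (X₂ ⊗ X₃) ≫ L.obj X₁ ◁ OplaxMonoidal.δ L X₂ X₃ :=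
      OplaxMonoidal.associativity L X₁ X₂ X₃
    have he : e.inv.app _ ≫ G.map (L.map (α_ X₁ X₂ X₃).hom) =
        F.map (α_ X₁ X₂ X₃).hom ≫ e.inv.app _ := (e.inv.naturality _).symm
    have hinv (X Y : I) : (e.inv.app (X ⊗ Y) ≫ G.map (OplaxMonoidal.δ L X Y)) ≫
        G.map (LaxMonoidal.μ L X Y) ≫ e.hom.app (X ⊗ Y) = 𝟙 (F.obj (X ⊗ Y)) := by
      rw [Category.assoc, ← Functor.map_comp_assoc, δ_μ, CategoryTheory.Functor.map_id,
        Category.id_comp]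
      exact e.inv_hom_id_app _
    simp only [Iso.refl_hom, Iso.refl_inv, CategoryTheory.Functor.map_id, Category.id_comp,
      Category.assoc, μIso_hom, μIso_inv, tensorHom_id, id_tensorHom]
    refine associativity_of_conjugates (e.hom.app X₁) (e.hom.app X₂) (e.hom.app X₃)
      (hinv X₁ X₂) (hinv X₂ X₃) (LaxMonoidal.associativity F X₁ X₂ X₃) ?_
    rw [← Functor.map_comp, Category.assoc, hL, Functor.map_comp, reassoc_of% he]
  · have : PreservesColimitsOfSize.{u, u} (G ⋙ tensorUnitLeft C) :=
      inferInstanceAs (PreservesColimitsOfSize.{u, u} (G ⋙ tensorLeft (𝟙_ C)))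
    refine natTrans_ext L (fun X₂ ↦ ?_)
    have : G.map (OplaxMonoidal.η L) ▷ G.obj (L.obj X₂) ≫ (μ.hom.app (𝟙_ P)).app (L.obj X₂) =
        (μ.hom.app (L.obj (𝟙_ I))).app (L.obj X₂) ≫ G.map (OplaxMonoidal.η L ▷ L.obj X₂) :=
      NatTrans.congr_app (μ.hom.naturality (εIso L).inv) (L.obj X₂)
    change (λ_ (G.obj (L.obj X₂))).hom =
      (LaxMonoidal.ε F ≫ e.inv.app (𝟙_ I) ≫ G.map (OplaxMonoidal.η L)) ▷ G.obj (L.obj X₂) ≫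
        (μ.hom.app (𝟙_ P)).app (L.obj X₂) ≫ G.map (λ_ (L.obj X₂)).hom
    monoidal_simps
    simp [reassoc_of% this, hμ _ _, ← comp_whiskerRight_assoc,
      -comp_whiskerRight, MonoidalCategory.tensorHom_def, ← whisker_exchange_assoc, ← map_comp]
  · have : PreservesColimitsOfSize.{u, u} (G ⋙ tensorUnitRight C) :=
      inferInstanceAs (PreservesColimitsOfSize.{u, u} (G ⋙ tensorRight (𝟙_ C)))
    refine natTrans_ext L (fun X₁ ↦ ?_)
    have : G.obj (L.obj X₁) ◁ G.map (OplaxMonoidal.η L) ≫ (μ.hom.app (L.obj X₁)).app (𝟙_ P) =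
        (μ.hom.app (L.obj X₁)).app (L.obj (𝟙_ I)) ≫ G.map (L.obj X₁ ◁ OplaxMonoidal.η L) :=
      (μ.hom.app (L.obj X₁)).naturality (εIso L).inv
    change (ρ_ (G.obj (L.obj X₁))).hom =
      G.obj (L.obj X₁) ◁ (LaxMonoidal.ε F ≫ e.inv.app (𝟙_ I) ≫ G.map (OplaxMonoidal.η L)) ≫
        (μ.hom.app (L.obj X₁)).app (𝟙_ P) ≫ G.map (ρ_ (L.obj X₁)).hom
    monoidal_simps
    simp [reassoc_of% this, hμ _ _, MonoidalCategory.tensorHom_def,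
      whisker_exchange_assoc, ← MonoidalCategory.whiskerLeft_comp_assoc, ← map_comp]

end Monoidal

section Braided

variable [MonoidalCategory I] [MonoidalCategory P] [MonoidalCategory C]
  [BraidedCategory I] [BraidedCategory P] [BraidedCategory C] [L.Braided]
  (F : I ⥤ C) [F.Braided] (G : P ⥤ C) [PreservesColimitsOfSize.{u, u} G]
  [∀ X : C, PreservesColimitsOfSize.{u, u} (tensorLeft X)]
  [∀ X : C, PreservesColimitsOfSize.{u, u} (tensorRight X)]

variable {L F G} in
lemma braided_of_isInducedTensorator {e : L ⋙ G ≅ F}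
    {μ : curriedTensorPre G ⟶ curriedTensorPost G}
    (hμ : IsInducedTensorator L F G e μ) (X Y : P) :
    (μ.app X).app Y ≫ G.map (β_ X Y).hom =
      (β_ (G.obj X) (G.obj Y)).hom ≫ (μ.app Y).app X := by
  let β₁ : curriedTensorPost G ⟶ (curriedTensorPost G).flip :=
    (postcompose₂.obj G).map (BraidedCategory.curriedBraidingNatIso P).hom
  let β₂ : curriedTensorPre G ⟶ (curriedTensorPre G).flip :=
    (((whiskeringLeft₂ _).obj G).obj G).map (BraidedCategory.curriedBraidingNatIso C).hom
  have h : μ ≫ β₁ = β₂ ≫ (flipFunctor _ _ _).map μ := by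
    refine natTrans₂_ext L (preservesColimits_curriedTensorPre_flip_obj G)
      (preservesColimits_curriedTensorPre_obj G) fun i j ↦ ?_
    change (μ.app (L.obj i)).app (L.obj j) ≫ G.map (β_ (L.obj i) (L.obj j)).hom =
      (β_ (G.obj (L.obj i)) (G.obj (L.obj j))).hom ≫ (μ.app (L.obj j)).app (L.obj i)
    have hL : OplaxMonoidal.δ L i j ≫ (β_ (L.obj i) (L.obj j)).hom =
        L.map (β_ i j).hom ≫ OplaxMonoidal.δ L j i := by
      simp
    have he : e.inv.app (i ⊗ j) ≫ G.map (L.map (β_ i j).hom) =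
        F.map (β_ i j).hom ≫ e.inv.app (j ⊗ i) := (e.inv.naturality (β_ i j).hom).symm
    rw [hμ, hμ]
    simp only [Category.assoc, ← Functor.map_comp, hL]
    simp only [Functor.map_comp]
    rw [reassoc_of% he, Functor.LaxBraided.braided_assoc,
      BraidedCategory.braiding_naturality_assoc]
    rfl
  exact NatTrans.congr_app (NatTrans.congr_app h X) Y

lemma nonempty_braided [∀ X : P, PreservesColimitsOfSize.{u, u} (tensorLeft X)]
    [∀ X : P, PreservesColimitsOfSize.{u, u} (tensorRight X)] (e : L ⋙ G ≅ F) :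
    Nonempty G.Braided := by
  obtain ⟨μ, hμ⟩ := exists_isInducedTensorator L F G e
  exact ⟨{ (coreMonoidal μ hμ).toMonoidal with
    braided := braided_of_isInducedTensorator hμ }⟩

end Braided

end DenseExtension

end

/-- **Cocontinuous extensions of (symmetric) strong monoidal functors along Yoneda are
(symmetric) strong monoidal (Im–Kelly).**

Let `I` be a small monoidal category and `C` a monoidal category with all small colimits
whose tensor product preserves colimits in each variable.  Equip the presheaf category
`Set^{Iᵒᵖ}` with the Day convolution monoidal structure (characterized by: the Yoneda
embedding is strong monoidal and the tensor product is cocontinuous in each variable).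
Given a strong monoidal functor `F : I ⥤ C`, any colimit-preserving extension
`G : Set^{Iᵒᵖ} ⥤ C` of `F` along the Yoneda embedding is strong monoidal; and if `I` and
`C` are symmetric monoidal and `F` is symmetric strong monoidal then so is `G`. -/
theorem day_convolution_extension_monoidal
    {I : Type u} [SmallCategory I] [MonoidalCategory I]
    {C : Type v} [Category.{u} C] [MonoidalCategory C]
    [HasColimitsOfSize.{u, u} C]
    [∀ X : C, PreservesColimitsOfSize.{u, u} (tensorLeft X)]
    [∀ X : C, PreservesColimitsOfSize.{u, u} (tensorRight X)]
    [MonoidalCategory (PSh I)]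
    [(pshYoneda I).Monoidal]
    [∀ X : PSh I, PreservesColimitsOfSize.{u, u} (tensorLeft X)]
    [∀ X : PSh I, PreservesColimitsOfSize.{u, u} (tensorRight X)]
    (F : I ⥤ C) [F.Monoidal]
    (G : PSh I ⥤ C) [PreservesColimitsOfSize.{u, u} G]
    (e : pshYoneda I ⋙ G ≅ F) :
    Nonempty G.Monoidal ∧
      (∀ [SymmetricCategory I] [SymmetricCategory C] [SymmetricCategory (PSh I)]
        [(pshYoneda I).Braided] [F.Braided],
        Nonempty G.Braided) := by
  constructor
  · obtain ⟨μ, hμ⟩ := DenseExtension.exists_isInducedTensorator (pshYoneda I) F G e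
    exact ⟨(DenseExtension.coreMonoidal μ hμ).toMonoidal⟩
  · intro _ _ _ _ _
    exact DenseExtension.nonempty_braided (pshYoneda I) F G e
end

section
/- In any category, a split pushout is an absolute pushout: if a commutative square with maps a₁ : A → B, a₂ : A → C, p₂ : B → P, p₁ : C → P admits maps d₀ : P → B, d₁ : C → A, d′₁ : B → A, d′₂ : B → A satisfying d₀p₁ = a₁d₁, d₀p₂ = a₁d′₁, a₂d₁ = id_C, a₂d′₁ = a₂d′₂, p₂d₀ = id_P, and a₁d′₂ = id_B, then the square is a pushout square, and its image under any functor is again a pushout square. -/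
open CategoryTheory Limits

universe w w' v u

/-- A commutative square as in the statement is an *absolute pushout* if its image under
every functor is a pushout square. -/
def IsAbsolutePushout {C : Type u} [Category.{v} C] {A B X P : C}
    (f : A ⟶ B) (g : A ⟶ X) (inl : B ⟶ P) (inr : X ⟶ P) : Prop :=
  ∀ {D : Type w} [Category.{w'} D] (F : C ⥤ D),
    IsPushout (F.map f) (F.map g) (F.map inl) (F.map inr)

theorem isPushout_of_splitting
    {𝒞 : Type u} [Category.{v} 𝒞] {A B C P : 𝒞}
    {a₁ : A ⟶ B} {a₂ : A ⟶ C} {p₂ : B ⟶ P} {p₁ : C ⟶ P}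
    (comm : a₁ ≫ p₂ = a₂ ≫ p₁)
    {d₀ : P ⟶ B} {d₁ : C ⟶ A} {d₁' d₂' : B ⟶ A}
    (h1 : p₁ ≫ d₀ = d₁ ≫ a₁)
    (h2 : p₂ ≫ d₀ = d₁' ≫ a₁)
    (h3 : d₁ ≫ a₂ = 𝟙 C)
    (h4 : d₁' ≫ a₂ = d₂' ≫ a₂)
    (h5 : d₀ ≫ p₂ = 𝟙 P)
    (h6 : d₂' ≫ a₁ = 𝟙 B) :
    IsPushout a₁ a₂ p₂ p₁ := by
  refine ⟨⟨comm⟩, ⟨PushoutCocone.IsColimit.mk comm (fun s => d₀ ≫ s.inl) ?_ ?_ ?_⟩⟩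
  · intro s
    rw [reassoc_of% h2, s.condition, reassoc_of% h4, ← s.condition, reassoc_of% h6]
  · intro s
    rw [reassoc_of% h1, s.condition, reassoc_of% h3]
  · intro s m hm _
    rw [← hm, reassoc_of% h5]

/-- **Split pushouts are absolute pushouts.**  If a commutative square with maps
`a₁ : A ⟶ B`, `a₂ : A ⟶ C`, `p₂ : B ⟶ P`, `p₁ : C ⟶ P` admits maps `d₀ : P ⟶ B`,
`d₁ : C ⟶ A`, `d₁' d₂' : B ⟶ A` satisfying the six splitting identities, then the square
is a pushout, and its image under any functor is again a pushout. -/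
theorem split_pushout_is_absolute_pushout
    {𝒞 : Type u} [Category.{v} 𝒞] {A B C P : 𝒞}
    (a₁ : A ⟶ B) (a₂ : A ⟶ C) (p₂ : B ⟶ P) (p₁ : C ⟶ P)
    (comm : a₁ ≫ p₂ = a₂ ≫ p₁)
    (d₀ : P ⟶ B) (d₁ : C ⟶ A) (d₁' : B ⟶ A) (d₂' : B ⟶ A)
    (h1 : p₁ ≫ d₀ = d₁ ≫ a₁)
    (h2 : p₂ ≫ d₀ = d₁' ≫ a₁)
    (h3 : d₁ ≫ a₂ = 𝟙 C)
    (h4 : d₁' ≫ a₂ = d₂' ≫ a₂)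
    (h5 : d₀ ≫ p₂ = 𝟙 P)
    (h6 : d₂' ≫ a₁ = 𝟙 B) :
    IsPushout a₁ a₂ p₂ p₁ ∧ IsAbsolutePushout.{w, w'} a₁ a₂ p₂ p₁ := by
  refine ⟨isPushout_of_splitting comm h1 h2 h3 h4 h5 h6, fun F => ?_⟩
  apply isPushout_of_splitting (d₀ := F.map d₀) (d₁ := F.map d₁)
    (d₁' := F.map d₁') (d₂' := F.map d₂') <;>
    simp only [← F.map_comp, ← F.map_id, *]
end

section
/- Let i : R → S be a thickening of categories, and suppose given objects r₁, r₂, r₃ of R, morphisms f : r₂ → r₃ and g : r₁ → r₃ in R, and a morphism σ : i r₁ → i r₂ in S with i(f) ∘ σ = i(g). Then σ lies in the image of i, and the triangle lifts to R: there is a morphism h : r₁ → r₂ in R with σ = i(h) and f ∘ h = g. -/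
open CategoryTheory

/-- A functor `i : R ⥤ S` is a *thickening* if it is an isomorphism on objects and, for all
objects `r, r'` of `R`, the map `Aut_S(i r) × R(r, r') → S(i r, i r')`, `(τ, f) ↦ i(f) ∘ τ`,
is a bijection of sets. -/
def IsThickening {R : Type*} {S : Type*} [Category R] [Category S] (i : R ⥤ S) : Prop :=
  Function.Bijective i.obj ∧
    ∀ r r' : R,
      Function.Bijective
        (fun p : Aut (i.obj r) × (r ⟶ r') => p.1.hom ≫ i.map p.2)

/-- **Lifting triangles along a thickening.**  Let `i : R ⥤ S` be a thickening, let
`f : r₂ ⟶ r₃` and `g : r₁ ⟶ r₃` be morphisms of `R`, and let `σ : i r₁ ⟶ i r₂` be a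
morphism of `S` with `i(f) ∘ σ = i(g)`.  Then `σ` lies in the image of `i` and the triangle
lifts to `R`: there is `h : r₁ ⟶ r₂` with `σ = i(h)` and `f ∘ h = g`. -/
theorem thickening_triangle_lift {R : Type*} {S : Type*} [Category R] [Category S]
    (i : R ⥤ S) (hi : IsThickening i) {r₁ r₂ r₃ : R}
    (f : r₂ ⟶ r₃) (g : r₁ ⟶ r₃) (σ : i.obj r₁ ⟶ i.obj r₂)
    (hσ : σ ≫ i.map f = i.map g) :
    ∃ h : r₁ ⟶ r₂, σ = i.map h ∧ h ≫ f = g := by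
  obtain ⟨⟨τ, h⟩, rfl⟩ := (hi.2 r₁ r₂).2 σ
  have key : (τ, h ≫ f) = ((1 : Aut (i.obj r₁)), g) :=
    (hi.2 r₁ r₃).1 <| by
      change τ.hom ≫ i.map (h ≫ f) = 𝟙 _ ≫ i.map g
      rw [Category.id_comp, i.map_comp, ← Category.assoc]
      exact hσ
  obtain ⟨rfl, hg⟩ := Prod.mk.inj key
  exact ⟨h, Category.id_comp _, hg⟩
end
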